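/- Lemma 3.6: let 𝓕 be a symmetric third-order tensor on ℝⁿ with trilinear form F, let G be the modification trilinear form built from the vectors ē_i = (1/3)𝟙 + (2/3)e_i, set F_α = F + α·G, and fix α₀ ∈ ℝ with α₀ ≥ 0. Suppose u ∈ M satisfies F_{α₀}(u,u,z) ≤ F_{α₀}(u,u,u) for all z ∈ M (i.e. u maximizes z ↦ F_{α₀}(u,u,z) over M). Then for every α ≥ α₀, u also maximizes z ↦ F_α(z,u,u) over M, i.e. F_α(z,u,u) ≤ F_α(u,u,u) for all z ∈ M. -/

import Mathlib

open Finset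

/-- The trilinear form associated to a third-order tensor `𝓕` indexed by a finite type. -/
def triForm {ι : Type*} [Fintype ι] (𝓕 : ι → ι → ι → ℝ) (x y z : ι → ℝ) : ℝ :=
  ∑ i, ∑ j, ∑ k, 𝓕 i j k * x i * y j * z k

/-- The perturbed basis vector `e_i^ε = ε·𝟙 + (1−ε)·e_i`. -/
def epsVec {ι : Type*} [DecidableEq ι] (ε : ℝ) (i : ι) : ι → ℝ :=
  fun j => ε + (1 - ε) * (if j = i then 1 else 0)

/-- The modification trilinear form `G_ε(x,y,z) = ∑_i ⟨e_i^ε,x⟩⟨e_i^ε,y⟩⟨e_i^ε,z⟩`. -/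
def Geps {ι : Type*} [Fintype ι] [DecidableEq ι] (ε : ℝ) (x y z : ι → ℝ) : ℝ :=
  ∑ i, (∑ j, epsVec ε i j * x j) * (∑ j, epsVec ε i j * y j) * (∑ j, epsVec ε i j * z j)

/-- The set of assignment matrices `M`, viewed as binary vectors indexed by
`Fin n₁ × Fin n₂`. -/
def assignSet (n₁ n₂ : ℕ) : Set (Fin n₁ × Fin n₂ → ℝ) :=
  {x | (∀ p, x p = 0 ∨ x p = 1) ∧ (∀ i, ∑ j, x (i, j) = 1) ∧ (∀ j, ∑ i, x (i, j) ≤ 1)}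

theorem epsVec_inner {ι : Type*} [Fintype ι] [DecidableEq ι] (ε : ℝ) (i : ι) (x : ι → ℝ) :
    ∑ j, epsVec ε i j * x j = ε * ∑ j, x j + (1 - ε) * x i := by
  simp only [epsVec, add_mul, Finset.sum_add_distrib, ← Finset.mul_sum, mul_assoc]
  simp

theorem assign_sum {n₁ n₂ : ℕ} {x : Fin n₁ × Fin n₂ → ℝ} (hx : x ∈ assignSet n₁ n₂) :
    ∑ p, x p = (n₁ : ℝ) := by
  rw [Fintype.sum_prod_type]
  simp [hx.2.1]

theorem Geps_le {n₁ n₂ : ℕ} {u z : Fin n₁ × Fin n₂ → ℝ} (hu : u ∈ assignSet n₁ n₂)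
    (hz : z ∈ assignSet n₁ n₂) : Geps (1 / 3) z u u ≤ Geps (1 / 3) u u u := by
  have hn : (0 : ℝ) ≤ n₁ := Nat.cast_nonneg _
  have key : ∑ p, (u p - z p) * (2 / 3 * (1 / 3 * n₁ + 2 / 3 : ℝ) ^ 2) ≤
      Geps (1 / 3) u u u - Geps (1 / 3) z u u := by
    unfold Geps
    rw [← Finset.sum_sub_distrib]
    apply Finset.sum_le_sum
    intro p _
    simp only [epsVec_inner, assign_sum hu, assign_sum hz]
    rcases hu.1 p with h | h <;> rcases hz.1 p with h' | h' <;> rw [h, h'] <;> nlinarith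
  rw [← Finset.sum_mul, Finset.sum_sub_distrib, assign_sum hu, assign_sum hz] at key
  linarith

theorem triForm_rot {ι : Type*} [Fintype ι] (𝓕 : ι → ι → ι → ℝ)
    (hsym₁ : ∀ i j k, 𝓕 i j k = 𝓕 j i k) (hsym₂ : ∀ i j k, 𝓕 i j k = 𝓕 i k j)
    (u z : ι → ℝ) : triForm 𝓕 z u u = triForm 𝓕 u u z := by
  unfold triForm
  rw [Finset.sum_comm]
  refine Finset.sum_congr rfl fun i _ => ?_
  rw [Finset.sum_comm]
  refine Finset.sum_congr rfl fun j _ => Finset.sum_congr rfl fun k _ => ?_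
  rw [hsym₁ k i j, hsym₂ i k j]
  ring

theorem Geps_rot {ι : Type*} [Fintype ι] [DecidableEq ι] (ε : ℝ) (u z : ι → ℝ) :
    Geps ε z u u = Geps ε u u z := by
  unfold Geps
  refine Finset.sum_congr rfl fun i _ => ?_
  ring

/-- Lemma 3.6: with `F_α = F + α·G` (`G = G_{1/3}`) and `α₀ ≥ 0`, if `u ∈ M` maximizes
`z ↦ F_{α₀}(u,u,z)` over `M`, then for every `α ≥ α₀`, `u` maximizes
`z ↦ F_α(z,u,u)` over `M`. -/
theorem lemma36 {n₁ n₂ : ℕ} (h₁ : 1 ≤ n₁) (h₁₂ : n₁ ≤ n₂)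
    (𝓕 : (Fin n₁ × Fin n₂) → (Fin n₁ × Fin n₂) → (Fin n₁ × Fin n₂) → ℝ)
    (hsym₁ : ∀ i j k, 𝓕 i j k = 𝓕 j i k)
    (hsym₂ : ∀ i j k, 𝓕 i j k = 𝓕 i k j)
    (α₀ : ℝ) (hα₀ : 0 ≤ α₀)
    (u : Fin n₁ × Fin n₂ → ℝ) (hu : u ∈ assignSet n₁ n₂)
    (hmax : ∀ z ∈ assignSet n₁ n₂,
      triForm 𝓕 u u z + α₀ * Geps (1 / 3) u u z ≤
        triForm 𝓕 u u u + α₀ * Geps (1 / 3) u u u) :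
    ∀ α ≥ α₀, ∀ z ∈ assignSet n₁ n₂,
      triForm 𝓕 z u u + α * Geps (1 / 3) z u u ≤
        triForm 𝓕 u u u + α * Geps (1 / 3) u u u := by
  intro α hα z hz
  have h := hmax z hz
  have hG := Geps_le hu hz
  rw [← triForm_rot 𝓕 hsym₁ hsym₂, ← Geps_rot] at h
  nlinarith [mul_le_mul_of_nonneg_left hG (sub_nonneg.2 hα)]
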